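/- arXiv:math/0606781 — 6 statements merged into one kernel-verified Lean document; each statement's English description precedes it below -/
import Mathlib

section
/- Let 0 < q < 1 be a real number and let z be any complex number. Then the infinite product (z;q)_∞ has the series expansion (z;q)_∞ = Σ_{k=0}^∞ (q^{k(k-1)/2} / (q;q)_k) · (−z)^k, where the series converges absolutely. -/
/-- The infinite q-Pochhammer symbol `(a;q)_∞ = ∏_{k=0}^∞ (1 - a qᵏ)`. -/
noncomputable def qPochInf (a : ℂ) (q : ℝ) : ℂ := ∏' k : ℕ, (1 - a * (q : ℂ) ^ k)

/-- The finite q-Pochhammer symbol `(a;q)_n = ∏_{j=0}^{n-1} (1 - a qʲ)`. -/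
noncomputable def qPoch (a : ℂ) (q : ℝ) (n : ℕ) : ℂ :=
  ∏ j ∈ Finset.range n, (1 - a * (q : ℂ) ^ j)

/-- The `k`-th term of Euler's expansion of `(z;q)_∞`. -/
noncomputable def eulerTerm (q : ℝ) (z : ℂ) (k : ℕ) : ℂ :=
  (q : ℂ) ^ (k * (k - 1) / 2) / qPoch (q : ℂ) q k * (-z) ^ k

theorem one_sub_pow_succ_ne_zero {q : ℝ} (hq0 : 0 < q) (hq1 : q < 1) (k : ℕ) :
    (1 - (q : ℂ) ^ (k + 1)) ≠ 0 := by
  have h : (1 - q ^ (k + 1)) ≠ 0 := (sub_pos.2 (pow_lt_one₀ hq0.le hq1 k.succ_ne_zero)).ne'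
  exact_mod_cast h

theorem qPoch_self_succ (q : ℝ) (k : ℕ) :
    qPoch (q : ℂ) q (k + 1) = qPoch (q : ℂ) q k * (1 - (q : ℂ) ^ (k + 1)) := by
  rw [qPoch, Finset.prod_range_succ, ← qPoch, pow_succ']

theorem eulerTerm_zero_right (q : ℝ) (z : ℂ) : eulerTerm q z 0 = 1 := by
  simp [eulerTerm, qPoch]

theorem eulerTerm_mul_pow (q : ℝ) (z w : ℂ) (k : ℕ) :
    eulerTerm q (z * w) k = eulerTerm q z k * w ^ k := by
  rw [eulerTerm, eulerTerm, ← neg_mul, mul_pow, mul_assoc]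

theorem eulerTerm_succ (q : ℝ) (z : ℂ) (k : ℕ) :
    eulerTerm q z (k + 1) =
      -z * (q : ℂ) ^ k / (1 - (q : ℂ) ^ (k + 1)) * eulerTerm q z k := by
  have h : (k + 1) * (k + 1 - 1) / 2 = k * (k - 1) / 2 + k := by
    simpa only [Finset.sum_range_id] using Finset.sum_range_succ (fun i => i) k
  rw [eulerTerm, eulerTerm, qPoch_self_succ, h, pow_add, pow_succ (-z)]
  simp only [div_eq_mul_inv, mul_inv]
  ring

theorem summable_norm_eulerTerm {q : ℝ} (hq0 : 0 < q) (hq1 : q < 1) (z : ℂ) :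
    Summable (fun k => ‖eulerTerm q z k‖) := by
  have hpow : Filter.Tendsto (fun k : ℕ => (q : ℂ) ^ k) Filter.atTop (nhds 0) :=
    tendsto_pow_atTop_nhds_zero_of_norm_lt_one (by simpa [abs_of_pos hq0] using hq1)
  have hlim : Filter.Tendsto (fun k : ℕ => ‖-z * (q : ℂ) ^ k / (1 - (q : ℂ) ^ (k + 1))‖)
      Filter.atTop (nhds 0) := by
    simpa using ((hpow.const_mul (-z)).div
      ((hpow.comp (Filter.tendsto_add_atTop_nat 1)).const_sub 1) (by simp)).norm
  refine summable_of_ratio_norm_eventually_le (r := 1 / 2) (by norm_num) ?_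
  filter_upwards [hlim.eventually_le_const (show (0 : ℝ) < 1 / 2 by norm_num)] with k hk
  rw [norm_norm, norm_norm, eulerTerm_succ, norm_mul]
  exact mul_le_mul_of_nonneg_right hk (norm_nonneg (eulerTerm q z k))

theorem tsum_eulerTerm_eq_mul {q : ℝ} (hq0 : 0 < q) (hq1 : q < 1) (z : ℂ) :
    ∑' k, eulerTerm q z k = (1 - z) * ∑' k, eulerTerm q (z * q) k := by
  have hs : ∀ w, Summable (eulerTerm q w) := fun w => (summable_norm_eulerTerm hq0 hq1 w).of_norm
  have hterm : ∀ k, eulerTerm q z (k + 1) =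
      eulerTerm q (z * q) (k + 1) - z * eulerTerm q (z * q) k := fun k => by
    have := one_sub_pow_succ_ne_zero hq0 hq1 k
    rw [eulerTerm_mul_pow, eulerTerm_mul_pow, eulerTerm_succ]
    field_simp
    ring
  have hz := (hs z).tsum_eq_zero_add
  have hzq := (hs (z * q)).tsum_eq_zero_add
  simp_rw [hterm] at hz
  rw [((summable_nat_add_iff 1).2 (hs (z * q))).tsum_sub ((hs (z * q)).mul_left z),
    tsum_mul_left, eulerTerm_zero_right] at hz
  rw [eulerTerm_zero_right] at hzq
  linear_combination hz - hzq

theorem tsum_eulerTerm_eq_qPoch_mul {q : ℝ} (hq0 : 0 < q) (hq1 : q < 1) (z : ℂ) (n : ℕ) :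
    ∑' k, eulerTerm q z k = qPoch z q n * ∑' k, eulerTerm q (z * (q : ℂ) ^ n) k := by
  induction n with
  | zero => simp [qPoch]
  | succ n ih =>
    rw [ih, tsum_eulerTerm_eq_mul hq0 hq1, qPoch, qPoch, Finset.prod_range_succ, pow_succ]
    simp only [mul_assoc]

theorem tendsto_tsum_eulerTerm_mul_pow {q : ℝ} (hq0 : 0 < q) (hq1 : q < 1) (z : ℂ) :
    Filter.Tendsto (fun n : ℕ => ∑' k, eulerTerm q (z * (q : ℂ) ^ n) k) Filter.atTop
      (nhds 1) := by
  have hq : ‖(q : ℂ)‖ < 1 := by simpa [abs_of_pos hq0] using hq1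
  have hsum : ∑' k, eulerTerm q z k * (0 : ℂ) ^ k = 1 := by
    rw [tsum_eq_single 0 (fun k hk => by simp [hk]), eulerTerm_zero_right]
    simp
  rw [← hsum]
  refine tendsto_tsum_of_dominated_convergence (summable_norm_eulerTerm hq0 hq1 z) (fun k => ?_)
    (Filter.Eventually.of_forall fun n k => ?_)
  · simp_rw [eulerTerm_mul_pow]
    exact ((tendsto_pow_atTop_nhds_zero_of_norm_lt_one hq).pow k).const_mul _
  · rw [eulerTerm_mul_pow, norm_mul, norm_pow, norm_pow]
    exact mul_le_of_le_one_right (norm_nonneg _)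
      (pow_le_one₀ (by positivity) (pow_le_one₀ (norm_nonneg _) hq.le))

theorem tendsto_qPoch_qPochInf {q : ℝ} (hq0 : 0 < q) (hq1 : q < 1) (z : ℂ) :
    Filter.Tendsto (qPoch z q) Filter.atTop (nhds (qPochInf z q)) := by
  have hsum : Summable (fun k : ℕ => ‖-(z * (q : ℂ) ^ k)‖) := by
    simpa [abs_of_pos hq0] using (summable_geometric_of_lt_one hq0.le hq1).mul_left ‖z‖
  have hm : Multipliable (fun k : ℕ => 1 - z * (q : ℂ) ^ k) := by
    simpa only [sub_eq_add_neg] using multipliable_one_add_of_summable hsum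
  exact hm.hasProd.tendsto_prod_nat

/-- For `0 < q < 1` and any complex `z`,
`(z;q)_∞ = Σ_{k=0}^∞ (q^{k(k-1)/2} / (q;q)_k) (-z)^k`, with absolute convergence. -/
theorem qPochInf_eq_sum (q : ℝ) (hq0 : 0 < q) (hq1 : q < 1) (z : ℂ) :
    Summable (fun k : ℕ => ‖(q : ℂ) ^ (k * (k - 1) / 2) / qPoch (q : ℂ) q k * (-z) ^ k‖) ∧
    qPochInf z q = ∑' k : ℕ, (q : ℂ) ^ (k * (k - 1) / 2) / qPoch (q : ℂ) q k * (-z) ^ k := by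
  refine ⟨summable_norm_eulerTerm hq0 hq1 z, ?_⟩
  have h := (tendsto_qPoch_qPochInf hq0 hq1 z).mul (tendsto_tsum_eulerTerm_mul_pow hq0 hq1 z)
  simp_rw [← tsum_eulerTerm_eq_qPoch_mul hq0 hq1 z, mul_one] at h
  exact tendsto_nhds_unique h tendsto_const_nhds
end

section
/- Let 0 < q < 1 be a real number, let a be a complex number, and let z be a complex number with |z| < 1. Then (az;q)_∞ / (z;q)_∞ = Σ_{k=0}^∞ ((a;q)_k / (q;q)_k) · z^k (the q-binomial theorem). -/
open Filter Topology

lemma one_sub_ofReal_pow_succ_ne_zero {q : ℝ} (hq0 : 0 < q) (hq1 : q < 1) (k : ℕ) :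
    1 - (q : ℂ) ^ (k + 1) ≠ 0 := by
  have h : q ^ (k + 1) < 1 := pow_lt_one₀ hq0.le hq1 k.succ_ne_zero
  exact_mod_cast (sub_pos.2 h).ne'

lemma qPoch_self_ne_zero {q : ℝ} (hq0 : 0 < q) (hq1 : q < 1) (k : ℕ) :
    qPoch (q : ℂ) q k ≠ 0 := by
  refine Finset.prod_ne_zero_iff.2 fun j _ ↦ ?_
  rw [← pow_succ']
  exact one_sub_ofReal_pow_succ_ne_zero hq0 hq1 j

lemma qPoch_succ (a : ℂ) (q : ℝ) (n : ℕ) :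
    qPoch a q (n + 1) = qPoch a q n * (1 - a * (q : ℂ) ^ n) :=
  Finset.prod_range_succ _ _

/-- The two-term recurrence of the coefficients of the q-binomial series. -/
lemma qPoch_div_succ (a : ℂ) (q : ℝ) (k : ℕ) :
    qPoch a q (k + 1) / qPoch (q : ℂ) q (k + 1) =
      qPoch a q k / qPoch (q : ℂ) q k * ((1 - a * (q : ℂ) ^ k) / (1 - (q : ℂ) ^ (k + 1))) := by
  rw [qPoch_succ, qPoch_succ, mul_div_mul_comm, ← pow_succ']

lemma tendsto_ofReal_pow_zero {q : ℝ} (hq0 : 0 < q) (hq1 : q < 1) :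
    Tendsto (fun n : ℕ ↦ (q : ℂ) ^ n) atTop (𝓝 0) :=
  tendsto_pow_atTop_nhds_zero_of_norm_lt_one (by simpa [abs_of_pos hq0] using hq1)

lemma summable_qBinomial {q : ℝ} (hq0 : 0 < q) (hq1 : q < 1) (a : ℂ) {z : ℂ} (hz : ‖z‖ < 1) :
    Summable fun k : ℕ ↦ qPoch a q k / qPoch (q : ℂ) q k * z ^ k := by
  obtain ⟨r, hzr, hr1⟩ := exists_between hz
  have hq := tendsto_ofReal_pow_zero hq0 hq1
  have hlim : Tendsto (fun k : ℕ ↦ ‖(1 - a * (q : ℂ) ^ k) / (1 - (q : ℂ) ^ (k + 1)) * z‖)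
      atTop (𝓝 ‖z‖) := by
    have h := ((((hq.const_mul a).const_sub 1).div
      ((hq.comp (tendsto_add_atTop_nat 1)).const_sub 1) (by simp)).mul_const z).norm
    simpa using h
  refine summable_of_ratio_norm_eventually_le hr1 ?_
  filter_upwards [hlim.eventually_le_const hzr] with k hk
  rw [qPoch_div_succ, pow_succ z, mul_mul_mul_comm, norm_mul, mul_comm]
  exact mul_le_mul_of_nonneg_right hk (norm_nonneg _)

lemma norm_ofReal_pow_mul_le {q : ℝ} (hq0 : 0 < q) (hq1 : q < 1) (z : ℂ) (n : ℕ) :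
    ‖(q : ℂ) ^ n * z‖ ≤ ‖z‖ := by
  rw [norm_mul, norm_pow, Complex.norm_real, Real.norm_of_nonneg hq0.le]
  exact mul_le_of_le_one_left (norm_nonneg z) (pow_le_one₀ hq0.le hq1.le)

/-- The q-difference equation satisfied by the q-binomial series. -/
lemma one_sub_mul_tsum_qBinomial {q : ℝ} (hq0 : 0 < q) (hq1 : q < 1) (a : ℂ) {z : ℂ}
    (hz : ‖z‖ < 1) :
    (1 - z) * ∑' k : ℕ, qPoch a q k / qPoch (q : ℂ) q k * z ^ k =
      (1 - a * z) * ∑' k : ℕ, qPoch a q k / qPoch (q : ℂ) q k * ((q : ℂ) * z) ^ k := by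
  have hqz : ‖(q : ℂ) * z‖ < 1 := by
    simpa using (norm_ofReal_pow_mul_le hq0 hq1 z 1).trans_lt hz
  have hF := summable_qBinomial hq0 hq1 a hz
  have hG := summable_qBinomial hq0 hq1 a hqz
  have hshift := (hF.sub hG).tsum_eq_zero_add
  have hterm (k : ℕ) :
      qPoch a q (k + 1) / qPoch (q : ℂ) q (k + 1) * z ^ (k + 1) -
        qPoch a q (k + 1) / qPoch (q : ℂ) q (k + 1) * ((q : ℂ) * z) ^ (k + 1) =
      z * (qPoch a q k / qPoch (q : ℂ) q k * z ^ k) -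
        a * z * (qPoch a q k / qPoch (q : ℂ) q k * ((q : ℂ) * z) ^ k) := by
    have h := one_sub_ofReal_pow_succ_ne_zero hq0 hq1 k
    have h' := qPoch_self_ne_zero hq0 hq1 k
    rw [qPoch_div_succ, mul_pow, mul_pow]
    field_simp
    ring
  simp only [hterm] at hshift
  rw [hF.tsum_sub hG, (hF.mul_left z).tsum_sub (hG.mul_left (a * z)), tsum_mul_left,
    tsum_mul_left] at hshift
  simp only [pow_zero, sub_self, zero_add] at hshift
  linear_combination hshift

lemma qPoch_mul_tsum_qBinomial {q : ℝ} (hq0 : 0 < q) (hq1 : q < 1) (a : ℂ) {z : ℂ}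
    (hz : ‖z‖ < 1) (n : ℕ) :
    qPoch z q n * ∑' k : ℕ, qPoch a q k / qPoch (q : ℂ) q k * z ^ k =
      qPoch (a * z) q n *
        ∑' k : ℕ, qPoch a q k / qPoch (q : ℂ) q k * ((q : ℂ) ^ n * z) ^ k := by
  induction n with
  | zero => simp [qPoch]
  | succ n ih =>
    have h := one_sub_mul_tsum_qBinomial hq0 hq1 a
      ((norm_ofReal_pow_mul_le hq0 hq1 z n).trans_lt hz)
    rw [← mul_assoc (q : ℂ), ← pow_succ'] at h
    rw [qPoch_succ, qPoch_succ]
    linear_combination (1 - z * (q : ℂ) ^ n) * ih + qPoch (a * z) q n * h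

lemma tendsto_tsum_qBinomial {q : ℝ} (hq0 : 0 < q) (hq1 : q < 1) (a : ℂ) {z : ℂ}
    (hz : ‖z‖ < 1) :
    Tendsto (fun n : ℕ ↦ ∑' k : ℕ, qPoch a q k / qPoch (q : ℂ) q k * ((q : ℂ) ^ n * z) ^ k)
      atTop (𝓝 1) := by
  have hsum : ∑' k : ℕ, qPoch a q k / qPoch (q : ℂ) q k * (0 : ℂ) ^ k = 1 := by
    rw [tsum_eq_single 0 fun k hk ↦ by simp [hk]]
    simp [qPoch]
  rw [← hsum]
  refine tendsto_tsum_of_dominated_convergence (summable_qBinomial hq0 hq1 a hz).norm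
    (fun k ↦ ?_) (.of_forall fun n k ↦ ?_)
  · have h := (tendsto_ofReal_pow_zero hq0 hq1).mul_const z
    rw [zero_mul] at h
    exact (h.pow k).const_mul _
  · rw [norm_mul, norm_mul, norm_pow, norm_pow z]
    gcongr
    exact norm_ofReal_pow_mul_le hq0 hq1 z n

lemma summable_norm_neg_mul_ofReal_pow {q : ℝ} (hq0 : 0 < q) (hq1 : q < 1) (x : ℂ) :
    Summable fun k : ℕ ↦ ‖-(x * (q : ℂ) ^ k)‖ := by
  simp only [norm_neg, norm_mul, norm_pow, Complex.norm_real, Real.norm_of_nonneg hq0.le]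
  exact (summable_geometric_of_lt_one hq0.le hq1).mul_left _

lemma tendsto_qPoch {q : ℝ} (hq0 : 0 < q) (hq1 : q < 1) (x : ℂ) :
    Tendsto (qPoch x q) atTop (𝓝 (qPochInf x q)) := by
  have h := (multipliable_one_add_of_summable
    (summable_norm_neg_mul_ofReal_pow hq0 hq1 x)).hasProd.tendsto_prod_nat
  simp only [← sub_eq_add_neg] at h
  exact h

lemma qPochInf_ne_zero {q : ℝ} (hq0 : 0 < q) (hq1 : q < 1) {z : ℂ} (hz : ‖z‖ < 1) :
    qPochInf z q ≠ 0 := by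
  have h := tprod_one_add_ne_zero_of_summable (f := fun k : ℕ ↦ -(z * (q : ℂ) ^ k))
    (fun k h0 ↦ ?_) (summable_norm_neg_mul_ofReal_pow hq0 hq1 z)
  · simp only [← sub_eq_add_neg] at h
    exact h
  · have hlt := (norm_ofReal_pow_mul_le hq0 hq1 z k).trans_lt hz
    rw [← sub_eq_add_neg, sub_eq_zero] at h0
    rw [mul_comm, ← h0, norm_one] at hlt
    exact hlt.false

/-- The q-binomial theorem: for `0 < q < 1`, any complex `a`, and `|z| < 1`,
`(az;q)_∞ / (z;q)_∞ = Σ_{k=0}^∞ ((a;q)_k / (q;q)_k) z^k`. -/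
theorem q_binomial (q : ℝ) (hq0 : 0 < q) (hq1 : q < 1) (a z : ℂ) (hz : ‖z‖ < 1) :
    qPochInf (a * z) q / qPochInf z q =
      ∑' k : ℕ, qPoch a q k / qPoch (q : ℂ) q k * z ^ k := by
  have hl := (tendsto_qPoch hq0 hq1 z).mul_const
    (∑' k : ℕ, qPoch a q k / qPoch (q : ℂ) q k * z ^ k)
  have hr := (tendsto_qPoch hq0 hq1 (a * z)).mul (tendsto_tsum_qBinomial hq0 hq1 a hz)
  simp only [← qPoch_mul_tsum_qBinomial hq0 hq1 a hz, mul_one] at hr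
  rw [div_eq_iff (qPochInf_ne_zero hq0 hq1 hz), mul_comm (tsum _)]
  exact tendsto_nhds_unique hr hl
end

section
/- Let 0 < q < 1 be a real number and let z be any complex number. Then |((1−q)z; q)_∞| ≤ e^{|z|}. -/
/-- If `‖f i‖` is summable, then `‖∏ (1 + f i)‖ ≤ exp (∑ ‖f i‖)`. -/
theorem norm_tprod_one_add_le_exp_tsum {ι : Type*} {f : ι → ℂ} (hf : Summable fun i => ‖f i‖) :
    ‖∏' i, (1 + f i)‖ ≤ Real.exp (∑' i, ‖f i‖) := by
  refine le_of_tendsto (multipliable_one_add_of_summable hf).hasProd.norm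
    (Filter.Eventually.of_forall fun s => ?_)
  calc ∏ i ∈ s, ‖1 + f i‖
    _ ≤ ∏ i ∈ s, (1 + ‖f i‖) :=
        Finset.prod_le_prod (fun _ _ => norm_nonneg _) fun i _ => by
          simpa using norm_add_le (1 : ℂ) (f i)
    _ ≤ Real.exp (∑ i ∈ s, ‖f i‖) :=
        Real.prod_one_add_le_exp_sum s fun i => norm_nonneg (f i)
    _ ≤ Real.exp (∑' i, ‖f i‖) :=
        Real.exp_le_exp.2 (hf.sum_le_tsum s fun _ _ => norm_nonneg _)

/-- For `0 < q < 1` and any complex `z`, `|((1-q)z;q)_∞| ≤ e^{|z|}`. -/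
theorem qPochInf_le_exp (q : ℝ) (hq0 : 0 < q) (hq1 : q < 1) (z : ℂ) :
    ‖qPochInf ((1 - (q : ℂ)) * z) q‖ ≤ Real.exp ‖z‖ := by
  have hnorm (k : ℕ) : ‖-((1 - (q : ℂ)) * z * (q : ℂ) ^ k)‖ = (1 - q) * ‖z‖ * q ^ k := by
    have h : ‖1 - (q : ℂ)‖ = 1 - q := by
      rw [← Complex.ofReal_one, ← Complex.ofReal_sub, Complex.norm_of_nonneg (by linarith)]
    rw [norm_neg, norm_mul, norm_mul, norm_pow, h, Complex.norm_of_nonneg hq0.le]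
  have hsum : HasSum (fun k : ℕ => ‖-((1 - (q : ℂ)) * z * (q : ℂ) ^ k)‖) ‖z‖ := by
    have hne : 1 - q ≠ 0 := by linarith
    have hgeom := (hasSum_geometric_of_lt_one hq0.le hq1).mul_left ((1 - q) * ‖z‖)
    rw [mul_right_comm, mul_inv_cancel₀ hne, one_mul] at hgeom
    simpa only [hnorm] using hgeom
  have hbound := norm_tprod_one_add_le_exp_tsum hsum.summable
  rw [hsum.tsum_eq] at hbound
  simpa only [qPochInf, sub_eq_add_neg] using hbound
end

section
/- Let z be any complex number. Then lim_{q → 1⁻} ((1−q)z; q)_∞ = e^{−z}, where the limit is taken as the real parameter q tends to 1 from below. -/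
/-- The logarithms of the factors of `((1-q)z;q)_∞` sum to `-z` up to an error `(1-q)‖z‖²`. -/
theorem exists_exp_eq_qPochInf (z : ℂ) {q : ℝ} (hq0 : 0 < q) (hq1 : q < 1)
    (hz : (1 - q) * ‖z‖ ≤ 1 / 2) :
    ∃ s : ℂ, Complex.exp s = qPochInf ((1 - (q : ℂ)) * z) q ∧
      ‖s - (-z)‖ ≤ (1 - q) * ‖z‖ ^ 2 := by
  set w : ℕ → ℂ := fun k => -((1 - (q : ℂ)) * z * (q : ℂ) ^ k) with hw
  have hq : (1 - (q : ℂ)) ≠ 0 := by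
    rw [sub_ne_zero]
    exact_mod_cast hq1.ne'
  have hnorm (k : ℕ) : ‖w k‖ = (1 - q) * ‖z‖ * q ^ k := by
    have h : ‖(1 - (q : ℂ))‖ = 1 - q := by
      rw [← Complex.ofReal_one, ← Complex.ofReal_sub, Complex.norm_real,
        Real.norm_of_nonneg (by linarith)]
    simp [hw, h, abs_of_pos hq0]
  have hle (k : ℕ) : ‖w k‖ ≤ (1 - q) * ‖z‖ := by
    rw [hnorm]
    exact mul_le_of_le_one_right (mul_nonneg (by linarith) (norm_nonneg z))
      (pow_le_one₀ hq0.le hq1.le)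
  have hlt (k : ℕ) : ‖w k‖ < 1 := by linarith [hle k]
  have hsum : HasSum w (-z) := by
    have h := ((hasSum_geometric_of_norm_lt_one (ξ := (q : ℂ))
      (by simpa [abs_of_pos hq0] using hq1)).mul_left ((1 - (q : ℂ)) * z)).neg
    rwa [mul_right_comm, mul_inv_cancel₀ hq, one_mul] at h
  have hlog : Summable fun k => Complex.log (1 + w k) :=
    Complex.summable_log_one_add_of_summable hsum.summable
  refine ⟨∑' k, Complex.log (1 + w k), ?_, ?_⟩
  · rw [Complex.cexp_tsum_eq_tprod _ hlog]
    · simp only [qPochInf, hw, ← sub_eq_add_neg]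
    · intro k h
      have h' : w k = -1 := by linear_combination h
      have := hlt k
      simp [h'] at this
  · have hbound : HasSum (fun k => (1 - q) * ‖z‖ * ((1 - q) * ‖z‖ * q ^ k))
        ((1 - q) * ‖z‖ ^ 2) := by
      have h := ((hasSum_geometric_of_lt_one hq0.le hq1).mul_left
        ((1 - q) * ‖z‖)).mul_left ((1 - q) * ‖z‖)
      have hne : 1 - q ≠ 0 := by linarith
      have heq : (1 - q) * ‖z‖ * ((1 - q) * ‖z‖ * (1 - q)⁻¹) = (1 - q) * ‖z‖ ^ 2 := by
        field_simp
      rwa [heq] at h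
    rw [← (hlog.hasSum.sub hsum).tsum_eq]
    refine tsum_of_norm_bounded hbound fun k => ?_
    refine (Complex.norm_log_one_add_sub_self_le (hlt k)).trans ?_
    have hinv : (1 - ‖w k‖)⁻¹ ≤ 2 := by
      rw [inv_le_comm₀ (by linarith [hlt k]) two_pos]
      linarith [hle k]
    rw [← hnorm]
    calc ‖w k‖ ^ 2 * (1 - ‖w k‖)⁻¹ / 2 ≤ ‖w k‖ ^ 2 * 2 / 2 := by gcongr
      _ = ‖w k‖ * ‖w k‖ := by ring
      _ ≤ (1 - q) * ‖z‖ * ‖w k‖ := by gcongr; exact hle k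

/-- For any complex `z`, `((1-q)z;q)_∞ → e^{-z}` as `q → 1⁻`. -/
theorem qPochInf_tendsto_exp (z : ℂ) :
    Filter.Tendsto (fun q : ℝ => qPochInf ((1 - (q : ℂ)) * z) q)
      (nhdsWithin 1 (Set.Iio 1)) (nhds (Complex.exp (-z))) := by
  have hlim (c : ℝ) : Filter.Tendsto (fun q : ℝ => (1 - q) * c)
      (nhdsWithin 1 (Set.Iio 1)) (nhds 0) := by
    have h : Continuous fun q : ℝ => (1 - q) * c := by fun_prop
    simpa using (h.tendsto 1).mono_left nhdsWithin_le_nhds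
  have hex : ∀ᶠ q : ℝ in nhdsWithin 1 (Set.Iio 1), ∃ s : ℂ,
      Complex.exp s = qPochInf ((1 - (q : ℂ)) * z) q ∧ ‖s - (-z)‖ ≤ (1 - q) * ‖z‖ ^ 2 := by
    filter_upwards [self_mem_nhdsWithin,
      nhdsWithin_le_nhds (lt_mem_nhds (zero_lt_one (α := ℝ))),
      (hlim ‖z‖).eventually_le_const one_half_pos] with q hq1 hq0 hz
    exact exists_exp_eq_qPochInf z hq0 hq1 hz
  obtain ⟨s, hs⟩ := hex.choice
  have hs_lim : Filter.Tendsto s (nhdsWithin 1 (Set.Iio 1)) (nhds (-z)) :=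
    tendsto_iff_norm_sub_tendsto_zero.2 <|
      squeeze_zero' (.of_forall fun _ => norm_nonneg _) (hs.mono fun _ h => h.2) (hlim _)
  exact ((Complex.continuous_exp.tendsto _).comp hs_lim).congr' (hs.mono fun _ h => h.1)
end

section
/- Let 0 < q < 1 be a real number and let m ≥ 0 and k ≥ 1 be integers. Then |(q^{m+k+1}; q)_∞ − 1| ≤ q^{m+2} · (−q³;q)_∞ / (1 − q). -/
/-- The real infinite q-Pochhammer symbol `(a;q)_∞ = ∏_{j=0}^∞ (1 - a qʲ)`. -/
noncomputable def qPochInfR (a q : ℝ) : ℝ := ∏' j : ℕ, (1 - a * q ^ j)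

theorem prod_one_sub_geometric_mem_Icc {a q : ℝ} (ha0 : 0 ≤ a) (ha1 : a ≤ 1) (hq0 : 0 ≤ q)
    (hq1 : q ≤ 1) (n : ℕ) :
    ∏ j ∈ Finset.range n, (1 - a * q ^ j) ∈
      Set.Icc (1 - a * ∑ j ∈ Finset.range n, q ^ j) 1 := by
  have hnonneg (j : ℕ) : 0 ≤ a * q ^ j := by positivity
  have hle (j : ℕ) : a * q ^ j ≤ 1 := mul_le_one₀ ha1 (by positivity) (pow_le_one₀ hq0 hq1)
  have hprod (n : ℕ) : ∏ j ∈ Finset.range n, (1 - a * q ^ j) ≤ 1 :=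
    Finset.prod_le_one (fun j _ => sub_nonneg.2 (hle j)) fun j _ => sub_le_self _ (hnonneg j)
  refine ⟨?_, hprod n⟩
  induction n with
  | zero => simp
  | succ n ih =>
    rw [Finset.prod_range_succ, Finset.sum_range_succ]
    nlinarith [mul_le_mul_of_nonneg_right (hprod n) (hnonneg n)]

theorem qPochInfR_mem_Icc {a q : ℝ} (ha0 : 0 ≤ a) (ha1 : a ≤ 1) (hq0 : 0 ≤ q) (hq1 : q < 1) :
    qPochInfR a q ∈ Set.Icc (1 - a / (1 - q)) 1 := by
  have hm : Multipliable fun j : ℕ => 1 - a * q ^ j := by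
    simpa only [sub_eq_add_neg] using Real.multipliable_one_add_of_summable
      ((summable_geometric_of_lt_one hq0 hq1).mul_left a).neg
  have hlim := hm.hasProd.tendsto_prod_nat
  have hmem := prod_one_sub_geometric_mem_Icc ha0 ha1 hq0 hq1.le
  have hsum := (hasSum_geometric_of_lt_one hq0 hq1).tendsto_sum_nat.const_mul a |>.const_sub 1
  rw [div_eq_mul_inv]
  exact ⟨le_of_tendsto_of_tendsto' hsum hlim fun n => (hmem n).1,
    le_of_tendsto' hlim fun n => (hmem n).2⟩

theorem one_le_tprod_one_add_pow {q : ℝ} (hq0 : 0 ≤ q) (hq1 : q < 1) (r : ℕ) :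
    1 ≤ ∏' j : ℕ, (1 + q ^ (j + r)) := by
  have hm : Multipliable fun j : ℕ => 1 + q ^ (j + r) :=
    Real.multipliable_one_add_of_summable
      ((summable_nat_add_iff r).2 (summable_geometric_of_lt_one hq0 hq1))
  refine ge_of_tendsto' hm.hasProd.tendsto_prod_nat fun n => ?_
  simpa using Finset.prod_le_prod (s := Finset.range n) (f := fun _ => (1 : ℝ))
    (fun _ _ => zero_le_one) fun j _ => le_add_of_nonneg_right (pow_nonneg hq0 (j + r))

/-- For `0 < q < 1`, `m ≥ 0` and `k ≥ 1`,
`|(q^{m+k+1};q)_∞ - 1| ≤ q^{m+2} (-q³;q)_∞ / (1-q)`,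
where `(-q³;q)_∞ = ∏_{j=0}^∞ (1 + q^{j+3})`. -/
theorem qPochInf_sub_one_tail_bound (q : ℝ) (hq0 : 0 < q) (hq1 : q < 1) (m k : ℕ)
    (hk : 1 ≤ k) :
    |qPochInfR (q ^ (m + k + 1)) q - 1| ≤
      q ^ (m + 2) * (∏' j : ℕ, (1 + q ^ (j + 3))) / (1 - q) := by
  obtain ⟨hlo, hhi⟩ := qPochInfR_mem_Icc (a := q ^ (m + k + 1)) (by positivity)
    (pow_le_one₀ hq0.le hq1.le) hq0.le hq1
  have hpos : 0 < 1 - q := sub_pos.2 hq1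
  rw [abs_of_nonpos (sub_nonpos.2 hhi)]
  calc -(qPochInfR (q ^ (m + k + 1)) q - 1) ≤ q ^ (m + k + 1) / (1 - q) := by linarith
    _ ≤ q ^ (m + 2) / (1 - q) := by
      gcongr ?_ / _
      exact pow_le_pow_of_le_one hq0.le hq1.le (by omega)
    _ ≤ q ^ (m + 2) * (∏' j : ℕ, (1 + q ^ (j + 3))) / (1 - q) := by
      gcongr
      exact le_mul_of_one_le_right (by positivity) (one_le_tprod_one_add_pow hq0.le hq1 3)
end

section
/- Let 0 < q < 1 be a real number, let u be a nonzero complex number, let λ ∈ [0,1) be a real number, and let m ≥ 0 be an integer. Then | Σ_{k=1}^{∞} q^{k²/2} (u q^{−λ})^k · ((q^{m+k+1};q)_∞ − 1) | ≤ q^{m+2} · (−q³;q)_∞ · θ(|u|^{−1} q^{λ}; q) / (1 − q), where powers of q with real exponents denote real powers. -/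
/-- The theta function `θ(x;q) = Σ_{k=-∞}^∞ q^{k²/2} xᵏ` for real `x ≠ 0`. -/
noncomputable def thetaR (x q : ℝ) : ℝ := ∑' k : ℤ, q ^ ((k : ℝ) ^ 2 / 2) * x ^ k

/-- The Weierstrass product inequality `1 - ∑ xᵢ ≤ ∏ (1 - xᵢ)` for `xᵢ ∈ [0,1]`. -/
theorem one_sub_sum_range_le_prod_one_sub {x : ℕ → ℝ} (h0 : ∀ i, 0 ≤ x i) (h1 : ∀ i, x i ≤ 1)
    (n : ℕ) : 1 - ∑ i ∈ Finset.range n, x i ≤ ∏ i ∈ Finset.range n, (1 - x i) := by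
  induction n with
  | zero => simp
  | succ n ih =>
    rw [Finset.sum_range_succ, Finset.prod_range_succ]
    have hp : ∏ i ∈ Finset.range n, (1 - x i) ≤ 1 :=
      Finset.prod_le_one (fun i _ => sub_nonneg.2 (h1 i)) (fun i _ => by linarith [h0 i])
    nlinarith [h0 n]

theorem abs_qPochInfR_sub_one_le {a q : ℝ} (ha0 : 0 ≤ a) (ha1 : a ≤ 1) (hq0 : 0 ≤ q)
    (hq1 : q < 1) : |qPochInfR a q - 1| ≤ a / (1 - q) := by
  have hx0 (j : ℕ) : 0 ≤ a * q ^ j := by positivity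
  have hx1 (j : ℕ) : a * q ^ j ≤ 1 := mul_le_one₀ ha1 (by positivity) (pow_le_one₀ hq0 hq1.le)
  have hsum : HasSum (fun j : ℕ => a * q ^ j) (a / (1 - q)) := by
    simpa [div_eq_mul_inv] using (hasSum_geometric_of_lt_one hq0 hq1).mul_left a
  have hmul : Multipliable fun j : ℕ => 1 - a * q ^ j := by
    simpa [sub_eq_add_neg] using
      multipliable_one_add_of_summable (f := fun j : ℕ => -(a * q ^ j))
        (by simpa using hsum.summable.abs)
  have htend := hmul.hasProd.tendsto_prod_nat
  have hlower : 1 - a / (1 - q) ≤ qPochInfR a q :=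
    ge_of_tendsto' htend fun n =>
      (sub_le_sub_left (sum_le_hasSum _ (fun j _ => hx0 j) hsum) 1).trans
        (one_sub_sum_range_le_prod_one_sub hx0 hx1 n)
  have hupper : qPochInfR a q ≤ 1 :=
    le_of_tendsto' htend fun n =>
      Finset.prod_le_one (fun j _ => sub_nonneg.2 (hx1 j)) (fun j _ => by linarith [hx0 j])
  rw [abs_le]
  constructor <;> linarith [div_nonneg ha0 (sub_nonneg.2 hq1.le)]

theorem summable_thetaR_term {x q : ℝ} (hx : 0 < x) (hq0 : 0 < q) (hq1 : q < 1) :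
    Summable fun k : ℤ => q ^ ((k : ℝ) ^ 2 / 2) * x ^ k := by
  have hτ : 0 < ((-Real.log q / (2 * Real.pi) : ℝ) * Complex.I).im := by
    rw [Complex.im_ofReal_mul, Complex.I_im, mul_one]
    exact div_pos (neg_pos.2 (Real.log_neg hq0 hq1)) Real.two_pi_pos
  refine ((summable_jacobiTheta₂_term_iff
    ((-Real.log x / (2 * Real.pi) : ℝ) * Complex.I) _).2 hτ).norm.congr fun k => ?_
  rw [norm_jacobiTheta₂_term, Real.rpow_def_of_pos hq0, ← Real.rpow_intCast,
    Real.rpow_def_of_pos hx, ← Real.exp_add, Complex.im_ofReal_mul, Complex.im_ofReal_mul,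
    Complex.I_im]
  congr 1
  field_simp
  ring

/-- For `0 < q < 1`, nonzero complex `u`, `λ ∈ [0,1)` and `m ≥ 0`,
`|Σ_{k=1}^∞ q^{k²/2} (u q^{-λ})^k ((q^{m+k+1};q)_∞ − 1)|
  ≤ q^{m+2} (-q³;q)_∞ θ(|u|⁻¹ q^λ;q)/(1-q)`.
The sum over `k ≥ 1` is indexed by `k = j + 1` with `j : ℕ`. -/
theorem tail_sum_bound (q : ℝ) (hq0 : 0 < q) (hq1 : q < 1) (u : ℂ) (hu : u ≠ 0)
    (lam : ℝ) (hlam : lam ∈ Set.Ico (0 : ℝ) 1) (m : ℕ) :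
    ‖∑' j : ℕ, ((q ^ (((j : ℝ) + 1) ^ 2 / 2) : ℝ) : ℂ) *
        (u * ((q ^ (-lam) : ℝ) : ℂ)) ^ (j + 1) *
        (((qPochInfR (q ^ (m + j + 2)) q : ℝ) : ℂ) - 1)‖ ≤
      q ^ (m + 2) * (∏' j : ℕ, (1 + q ^ (j + 3))) * thetaR (‖u‖⁻¹ * q ^ lam) q / (1 - q) := by
  have hx : 0 < ‖u‖⁻¹ * q ^ lam := by positivity
  have h1q : 0 < 1 - q := sub_pos.2 hq1
  have hprod : 1 ≤ ∏' j : ℕ, (1 + q ^ (j + 3)) := by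
    have hpow : Summable fun j : ℕ => q ^ (j + 3) :=
      (summable_nat_add_iff 3).2 (summable_geometric_of_lt_one hq0.le hq1)
    exact ge_of_tendsto' (multipliable_one_add_of_summable hpow.norm).hasProd.tendsto_prod_nat
      fun n => Finset.one_le_prod fun j _ => le_add_of_nonneg_right (by positivity)
  have hsum := summable_thetaR_term hx hq0 hq1
  have hinj : Function.Injective fun j : ℕ => -((j : ℤ) + 1) := fun i j h => by
    simpa using h
  have htheta_nonneg : 0 ≤ thetaR (‖u‖⁻¹ * q ^ lam) q := tsum_nonneg fun k => by positivity
  have hsub := hsum.comp_injective hinj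
  have htail : ∑' j : ℕ, q ^ (((j : ℝ) + 1) ^ 2 / 2) * (‖u‖ * q ^ (-lam)) ^ (j + 1) ≤
      thetaR (‖u‖⁻¹ * q ^ lam) q ∧
      Summable fun j : ℕ => q ^ (((j : ℝ) + 1) ^ 2 / 2) * (‖u‖ * q ^ (-lam)) ^ (j + 1) := by
    have hterm (j : ℕ) : q ^ (((j : ℝ) + 1) ^ 2 / 2) * (‖u‖ * q ^ (-lam)) ^ (j + 1) =
        q ^ (((-((j : ℤ) + 1) : ℤ) : ℝ) ^ 2 / 2) * (‖u‖⁻¹ * q ^ lam) ^ (-((j : ℤ) + 1)) := by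
      rw [zpow_neg, ← inv_zpow, mul_inv, inv_inv, ← Real.rpow_neg hq0.le]
      push_cast
      rw [neg_sq]
      norm_cast
    simp_rw [hterm]
    exact ⟨tsum_comp_le_tsum_of_inj hsum (fun k => by positivity) hinj, hsub⟩
  obtain ⟨htail_le, htail_summable⟩ := htail
  have hbound := tsum_of_norm_bounded (htail_summable.hasSum.mul_left (q ^ (m + 2) / (1 - q)))
    (f := fun j : ℕ => ((q ^ (((j : ℝ) + 1) ^ 2 / 2) : ℝ) : ℂ) *
        (u * ((q ^ (-lam) : ℝ) : ℂ)) ^ (j + 1) *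
        (((qPochInfR (q ^ (m + j + 2)) q : ℝ) : ℂ) - 1)) fun j => by
      have hpoch : |qPochInfR (q ^ (m + j + 2)) q - 1| ≤ q ^ (m + 2) / (1 - q) :=
        (abs_qPochInfR_sub_one_le (by positivity) (pow_le_one₀ hq0.le hq1.le) hq0.le hq1).trans
          (div_le_div_of_nonneg_right (pow_le_pow_of_le_one hq0.le hq1.le (by omega)) h1q.le)
      rw [norm_mul, norm_mul, norm_pow, norm_mul, Complex.norm_real, Complex.norm_real,
        Real.norm_of_nonneg (by positivity), Real.norm_of_nonneg (by positivity),
        ← Complex.ofReal_one, ← Complex.ofReal_sub, Complex.norm_real, Real.norm_eq_abs,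
        mul_comm (q ^ (m + 2) / (1 - q))]
      gcongr
  calc _ ≤ _ := hbound
    _ ≤ q ^ (m + 2) / (1 - q) * thetaR (‖u‖⁻¹ * q ^ lam) q := by gcongr
    _ = q ^ (m + 2) * 1 * thetaR (‖u‖⁻¹ * q ^ lam) q / (1 - q) := by ring
    _ ≤ _ := by gcongr
end
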